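/- Let B ⊆ ℝ³ be open and let T be a smooth symmetric (²₀)-tensor field on B (T^{IJ} = T^{JI}). Then there exists a smooth vector field Y : B → ℝ³ with T = grad^s Y, i.e. T^{IJ} = (∂_J Y^I + ∂_I Y^J)/2 on B for all I, J, if and only if all of the following hold: (i) curl∘curl T = 0 on B, i.e. ε_{IKL} ε_{JMN} ∂_K ∂_M T^{LN} = 0 on B for all I, J; (ii) for every smooth closed curve γ in B and every I, ∫₀¹ Σ_{J} [ T^{IJ}(γ(t)) − Σ_{K} γ^K(t) ( ∂_K T^{IJ} − ∂_I T^{JK} )(γ(t)) ] γ′^J(t) dt = 0; and (iii) for every smooth closed curve γ in B and all I, J, ∫₀¹ Σ_{K} ( ∂_J T^{IK} − ∂_I T^{JK} )(γ(t)) γ′^K(t) dt = 0. -/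

import Mathlib

/-- Partial derivative in the `K`-th coordinate direction. -/
noncomputable def pd {n : ℕ} (K : Fin n) (f : (Fin n → ℝ) → ℝ) (x : Fin n → ℝ) : ℝ :=
  fderiv ℝ f x (Pi.single K 1)

/-- A smooth closed curve lying in `B`. -/
def IsSmoothClosedCurveIn {n : ℕ} (B : Set (Fin n → ℝ)) (γ : ℝ → Fin n → ℝ) : Prop :=
  ContDiff ℝ (⊤ : ℕ∞) γ ∧ (∀ t, γ (t + 1) = γ t) ∧ ∀ t, γ t ∈ B

/-- The standard permutation symbol `ε_{ijk}` on `Fin 3`. -/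
noncomputable def eps (i j k : Fin 3) : ℝ :=
  (((j : ℕ) : ℝ) - ((i : ℕ) : ℝ)) * (((k : ℕ) : ℝ) - ((i : ℕ) : ℝ)) *
    (((k : ℕ) : ℝ) - ((j : ℕ) : ℝ)) / 2

open Set Filter Topology

section LineIntegral

variable {E : Type*} [NormedAddCommGroup E] [NormedSpace ℝ E]

/-- The integral of the 1-form `ω` along `γ` over the unit interval. -/
noncomputable def lineIntegral (ω : E → E →L[ℝ] ℝ) (γ : ℝ → E) : ℝ :=
  ∫ t in (0 : ℝ)..1, ω (γ t) (deriv γ t)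

/-- A smooth path in `B` which rests at `p` up to time `0` and at `q` from time `1` on. -/
structure IsSmoothPathIn (B : Set E) (γ : ℝ → E) (p q : E) : Prop where
  contDiff : ContDiff ℝ (⊤ : ℕ∞) γ
  mem : ∀ t, γ t ∈ B
  source : ∀ t ≤ 0, γ t = p
  target : ∀ t, 1 ≤ t → γ t = q

/-- The path `γ₁` followed by `γ₂`, when `γ₁` ends and `γ₂` starts at `q`. -/
noncomputable def concatPath (γ₁ γ₂ : ℝ → E) (q : E) (t : ℝ) : E :=
  γ₁ (2 * t) + γ₂ (2 * t - 1) - q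

/-- The segment from `p` to `q`, traversed with a smooth speed vanishing at the ends. -/
noncomputable def smoothSegment (p q : E) (t : ℝ) : E :=
  p + Real.smoothTransition t • (q - p)

variable {B : Set E} {ω : E → E →L[ℝ] ℝ} {γ γ₁ γ₂ : ℝ → E} {p q r : E}

lemma continuous_lineIntegrand (hω : ContinuousOn ω B) (hγ : ContDiff ℝ (⊤ : ℕ∞) γ)
    (hB : ∀ t, γ t ∈ B) : Continuous fun t => ω (γ t) (deriv γ t) :=
  (hω.comp_continuous hγ.continuous hB).clm_apply (hγ.continuous_deriv (by simp))

namespace IsSmoothPathIn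

lemma differentiable (h : IsSmoothPathIn B γ p q) : Differentiable ℝ γ :=
  h.contDiff.differentiable (by simp)

lemma deriv_source (h : IsSmoothPathIn B γ p q) {t : ℝ} (ht : t ≤ 0) : deriv γ t = 0 := by
  have h₁ := (h.differentiable t).hasDerivAt.hasDerivWithinAt (s := Iic t)
  have h₂ : HasDerivWithinAt γ 0 (Iic t) t :=
    (hasDerivWithinAt_const t (Iic t) p).congr (fun s hs => h.source s (le_trans hs ht))
      (h.source t ht)
  exact (uniqueDiffWithinAt_Iic t).eq_deriv _ h₁ h₂

lemma deriv_target (h : IsSmoothPathIn B γ p q) {t : ℝ} (ht : 1 ≤ t) : deriv γ t = 0 := by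
  have h₁ := (h.differentiable t).hasDerivAt.hasDerivWithinAt (s := Ici t)
  have h₂ : HasDerivWithinAt γ 0 (Ici t) t :=
    (hasDerivWithinAt_const t (Ici t) q).congr (fun s hs => h.target s (le_trans ht hs))
      (h.target t ht)
  exact (uniqueDiffWithinAt_Ici t).eq_deriv _ h₁ h₂

lemma const (hp : p ∈ B) : IsSmoothPathIn B (fun _ => p) p p :=
  ⟨contDiff_const, fun _ => hp, fun _ _ => rfl, fun _ _ => rfl⟩

lemma reverse (h : IsSmoothPathIn B γ p q) : IsSmoothPathIn B (fun t => γ (1 - t)) q p :=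
  ⟨h.contDiff.comp (contDiff_const.sub contDiff_id), fun _ => h.mem _,
    fun _ ht => h.target _ (by linarith), fun _ ht => h.source _ (by linarith)⟩

lemma lineIntegral_reverse (ω : E → E →L[ℝ] ℝ) (γ : ℝ → E) :
    lineIntegral ω (fun t => γ (1 - t)) = -lineIntegral ω γ := by
  have := intervalIntegral.integral_comp_sub_left (a := 0) (b := 1)
    (fun t => ω (γ t) (deriv γ t)) 1
  simp only [sub_self, sub_zero] at this
  simp [lineIntegral, ← this, deriv_comp_const_sub]

lemma concat_of_le (h₂ : IsSmoothPathIn B γ₂ q r) {t : ℝ} (ht : t ≤ 1 / 2) :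
    concatPath γ₁ γ₂ q t = γ₁ (2 * t) := by
  simp [concatPath, h₂.source (2 * t - 1) (by linarith)]

lemma concat_of_ge (h₁ : IsSmoothPathIn B γ₁ p q) {t : ℝ} (ht : 1 / 2 ≤ t) :
    concatPath γ₁ γ₂ q t = γ₂ (2 * t - 1) := by
  simp [concatPath, h₁.target (2 * t) (by linarith)]

lemma concat (h₁ : IsSmoothPathIn B γ₁ p q) (h₂ : IsSmoothPathIn B γ₂ q r) :
    IsSmoothPathIn B (concatPath γ₁ γ₂ q) p r where
  contDiff := by
    have := h₁.contDiff
    have := h₂.contDiff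
    unfold concatPath
    fun_prop
  mem t := by
    rcases le_total t (1 / 2) with ht | ht
    · rw [h₂.concat_of_le ht]; exact h₁.mem _
    · rw [h₁.concat_of_ge ht]; exact h₂.mem _
  source t ht := by rw [h₂.concat_of_le (by linarith), h₁.source _ (by linarith)]
  target t ht := by rw [h₁.concat_of_ge (by linarith), h₂.target _ (by linarith)]

lemma deriv_concat (h₁ : IsSmoothPathIn B γ₁ p q) (h₂ : IsSmoothPathIn B γ₂ q r) (t : ℝ) :
    deriv (concatPath γ₁ γ₂ q) t =
      (2 : ℝ) • deriv γ₁ (2 * t) + (2 : ℝ) • deriv γ₂ (2 * t - 1) := by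
  have hd : HasDerivAt (fun s : ℝ => 2 * s) 2 t := by
    simpa using (hasDerivAt_id t).const_mul 2
  have e₁ := (h₁.differentiable (2 * t)).hasDerivAt.scomp t hd
  have e₂ := (h₂.differentiable (2 * t - 1)).hasDerivAt.scomp t (hd.sub_const 1)
  exact ((e₁.add e₂).sub_const q).deriv

lemma lineIntegral_concat (hω : ContinuousOn ω B) (h₁ : IsSmoothPathIn B γ₁ p q)
    (h₂ : IsSmoothPathIn B γ₂ q r) :
    lineIntegral ω (concatPath γ₁ γ₂ q) = lineIntegral ω γ₁ + lineIntegral ω γ₂ := by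
  have hc := continuous_lineIntegrand hω (h₁.concat h₂).contDiff (h₁.concat h₂).mem
  have i₁ : ∫ t in (0 : ℝ)..1 / 2, ω (concatPath γ₁ γ₂ q t) (deriv (concatPath γ₁ γ₂ q) t) =
      lineIntegral ω γ₁ := by
    have := intervalIntegral.smul_integral_comp_mul_left (a := 0) (b := 1 / 2)
      (fun t => ω (γ₁ t) (deriv γ₁ t)) 2
    norm_num at this
    rw [lineIntegral, ← this, ← intervalIntegral.integral_const_mul]
    refine intervalIntegral.integral_congr fun t ht => ?_
    rw [uIcc_of_le (by norm_num)] at ht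
    simp only [h₁.deriv_concat h₂, h₂.concat_of_le ht.2,
      h₂.deriv_source (show 2 * t - 1 ≤ 0 by linarith [ht.2]), smul_zero, add_zero, map_smul,
      smul_eq_mul]
  have i₂ : ∫ t in (1 / 2 : ℝ)..1, ω (concatPath γ₁ γ₂ q t) (deriv (concatPath γ₁ γ₂ q) t) =
      lineIntegral ω γ₂ := by
    have := intervalIntegral.smul_integral_comp_mul_sub (a := 1 / 2) (b := 1)
      (fun t => ω (γ₂ t) (deriv γ₂ t)) 2 1
    norm_num at this
    rw [lineIntegral, ← this, ← intervalIntegral.integral_const_mul]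
    refine intervalIntegral.integral_congr fun t ht => ?_
    rw [uIcc_of_le (by norm_num)] at ht
    simp only [h₁.deriv_concat h₂, h₁.concat_of_ge ht.1,
      h₁.deriv_target (show 1 ≤ 2 * t by linarith [ht.1]), smul_zero, zero_add, map_smul,
      smul_eq_mul]
  rw [← i₁, ← i₂, lineIntegral]
  exact (intervalIntegral.integral_add_adjacent_intervals (hc.intervalIntegrable _ _)
    (hc.intervalIntegrable _ _)).symm

lemma comp_fract_eq (h : IsSmoothPathIn B γ p p) (m : ℤ) {t : ℝ} (h₁ : m - 1 < t)
    (h₂ : t < m + 1) : γ (Int.fract t) = γ (t - m) + γ (t - m + 1) - p := by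
  rcases lt_or_ge t m with ht | ht
  · have : ⌊t⌋ = m - 1 := by rw [Int.floor_eq_iff]; push_cast; constructor <;> linarith
    rw [Int.fract, this, h.source (t - m) (by linarith)]
    push_cast
    rw [add_sub_cancel_left]
    congr 1
    ring
  · have : ⌊t⌋ = m := by rw [Int.floor_eq_iff]; constructor <;> linarith
    rw [Int.fract, this, h.target (t - m + 1) (by linarith), add_sub_cancel_right]

lemma contDiff_comp_fract (h : IsSmoothPathIn B γ p p) :
    ContDiff ℝ (⊤ : ℕ∞) fun t => γ (Int.fract t) := by
  have hγ := h.contDiff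
  rw [contDiff_iff_contDiffAt]
  intro t
  have hs : ContDiff ℝ (⊤ : ℕ∞) fun s : ℝ => γ (s - ⌊t⌋) + γ (s - ⌊t⌋ + 1) - p := by fun_prop
  refine hs.contDiffAt.congr_of_eventuallyEq ?_
  have hl : (⌊t⌋ : ℝ) - 1 < t := by linarith [Int.floor_le t]
  filter_upwards [Ioo_mem_nhds hl (Int.lt_floor_add_one t)] with s hs
  exact h.comp_fract_eq _ hs.1 hs.2

lemma lineIntegral_comp_fract (ω : E → E →L[ℝ] ℝ) (γ : ℝ → E) :
    lineIntegral ω (fun t => γ (Int.fract t)) = lineIntegral ω γ := by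
  refine intervalIntegral.integral_congr_Ioo_of_le zero_le_one fun t ht => ?_
  have he : (fun t => γ (Int.fract t)) =ᶠ[𝓝 t] γ := by
    filter_upwards [Ioo_mem_nhds ht.1 ht.2] with s hs
    rw [Int.fract_eq_self.2 ⟨hs.1.le, hs.2⟩]
  simp only [he.deriv_eq, Int.fract_eq_self.2 ⟨ht.1.le, ht.2⟩]

end IsSmoothPathIn

lemma hasDerivAt_smoothSegment (p q : E) (t : ℝ) :
    HasDerivAt (smoothSegment p q) (deriv Real.smoothTransition t • (q - p)) t := by
  have := (Real.smoothTransition.contDiff (n := 1)).differentiable (by simp) t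
  exact (this.hasDerivAt.smul_const (q - p)).const_add p

lemma smoothSegment_mem_segment (p q : E) (t : ℝ) : smoothSegment p q t ∈ segment ℝ p q := by
  rw [segment_eq_image']
  exact ⟨_, ⟨Real.smoothTransition.nonneg t, Real.smoothTransition.le_one t⟩, rfl⟩

lemma isSmoothPathIn_smoothSegment (h : segment ℝ p q ⊆ B) :
    IsSmoothPathIn B (smoothSegment p q) p q where
  contDiff := contDiff_const.add (Real.smoothTransition.contDiff.smul contDiff_const)
  mem t := h (smoothSegment_mem_segment p q t)
  source t ht := by simp [smoothSegment, Real.smoothTransition.zero_of_nonpos ht]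
  target t ht := by simp [smoothSegment, Real.smoothTransition.one_of_one_le ht]

/-- The integrals of the 1-form `ω` over all smooth closed curves in `B` vanish. -/
def HasZeroPeriods (B : Set E) (ω : E → E →L[ℝ] ℝ) : Prop :=
  ∀ γ : ℝ → E, ContDiff ℝ (⊤ : ℕ∞) γ → (∀ t, γ (t + 1) = γ t) → (∀ t, γ t ∈ B) →
    lineIntegral ω γ = 0

lemma HasZeroPeriods.lineIntegral_eq (h : HasZeroPeriods B ω) (hω : ContinuousOn ω B)
    (h₁ : IsSmoothPathIn B γ₁ p q) (h₂ : IsSmoothPathIn B γ₂ p q) :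
    lineIntegral ω γ₁ = lineIntegral ω γ₂ := by
  have hc := h₁.concat h₂.reverse
  have := h _ hc.contDiff_comp_fract (fun t => by simp) fun t => hc.mem _
  rw [IsSmoothPathIn.lineIntegral_comp_fract, h₁.lineIntegral_concat hω h₂.reverse,
    IsSmoothPathIn.lineIntegral_reverse] at this
  linarith

/-- Line integrals along short segments are first-order approximated by the 1-form. -/
lemma lineIntegral_smoothSegment_isLittleO (hB : IsOpen B) (hω : ContinuousOn ω B) (hp : p ∈ B) :
    (fun q => lineIntegral ω (smoothSegment p q) - ω p (q - p)) =o[𝓝 p] fun q => q - p := by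
  have hs : ContDiff ℝ 1 Real.smoothTransition := Real.smoothTransition.contDiff
  have hsc : Continuous (deriv Real.smoothTransition) := hs.continuous_deriv le_rfl
  obtain ⟨C, hC⟩ := isCompact_Icc.exists_bound_of_continuousOn
    (s := Icc (0 : ℝ) 1) hsc.continuousOn
  have hC0 : 0 ≤ C := (norm_nonneg _).trans (hC 0 (by simp))
  have hs1 : ∫ t in (0 : ℝ)..1, deriv Real.smoothTransition t = 1 := by
    rw [intervalIntegral.integral_eq_sub_of_hasDerivAt
      (fun t _ => (hs.differentiable (by simp) t).hasDerivAt) (hsc.intervalIntegrable _ _)]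
    simp
  rw [Asymptotics.isLittleO_iff]
  intro c hc
  have hc' : 0 < c / (C + 1) := by positivity
  obtain ⟨δ, hδ, hball⟩ := Metric.mem_nhds_iff.1 (Filter.inter_mem (hB.mem_nhds hp)
    ((hω.continuousAt (hB.mem_nhds hp)).preimage_mem_nhds (Metric.ball_mem_nhds _ hc')))
  filter_upwards [Metric.ball_mem_nhds p hδ] with q hq
  have hseg : segment ℝ p q ⊆ Metric.ball p δ :=
    (convex_ball p δ).segment_subset (Metric.mem_ball_self hδ) hq
  have hpath : IsSmoothPathIn B (smoothSegment p q) p q :=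
    isSmoothPathIn_smoothSegment fun x hx => (hball (hseg hx)).1
  have hi := continuous_lineIntegrand hω hpath.contDiff hpath.mem
  have he : lineIntegral ω (smoothSegment p q) - ω p (q - p) =
      ∫ t in (0 : ℝ)..1, (ω (smoothSegment p q t) (deriv (smoothSegment p q) t) -
        deriv Real.smoothTransition t * ω p (q - p)) := by
    rw [intervalIntegral.integral_sub (hi.intervalIntegrable _ _)
      (Continuous.intervalIntegrable (by fun_prop) _ _),
      intervalIntegral.integral_mul_const, hs1, one_mul, lineIntegral]
  rw [he]
  refine (intervalIntegral.norm_integral_le_of_norm_le_const (C := c * ‖q - p‖) ?_).trans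
    (by simp)
  intro t ht
  rw [uIoc_of_le zero_le_one] at ht
  have hb : ‖ω (smoothSegment p q t) - ω p‖ < c / (C + 1) := by
    simpa [dist_eq_norm] using (hball (hseg (smoothSegment_mem_segment p q t))).2
  have hct := hC t ⟨ht.1.le, ht.2⟩
  rw [(hasDerivAt_smoothSegment p q t).deriv, map_smul, smul_eq_mul, ← mul_sub,
    ← sub_apply, norm_mul]
  calc _ ≤ C * (c / (C + 1) * ‖q - p‖) := by
        gcongr
        exact ((ω (smoothSegment p q t) - ω p).le_opNorm _).trans (by gcongr)
    _ = c * ‖q - p‖ * (C / (C + 1)) := by ring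
    _ ≤ c * ‖q - p‖ :=
        mul_le_of_le_one_right (by positivity) ((div_le_one (by positivity)).2 (by linarith))

/-- A continuous 1-form on an open set with vanishing integrals along smooth closed curves
has a potential. -/
theorem HasZeroPeriods.exists_hasFDerivAt (h : HasZeroPeriods B ω) (hB : IsOpen B)
    (hω : ContinuousOn ω B) : ∃ φ : E → ℝ, ∀ x ∈ B, HasFDerivAt φ (ω x) x := by
  let S : Setoid B :=
    { r := fun p q => ∃ γ, IsSmoothPathIn B γ p q
      iseqv :=
        { refl := fun p => ⟨_, .const p.2⟩
          symm := fun ⟨_, h⟩ => ⟨_, h.reverse⟩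
          trans := fun ⟨_, h₁⟩ ⟨_, h₂⟩ => ⟨_, h₁.concat h₂⟩ } }
  let base : B → B := fun x => (Quotient.mk S x).out
  have hbase : ∀ x : B, ∃ γ, IsSmoothPathIn B γ (base x : E) x := fun x =>
    Quotient.mk_out (s := S) x
  choose Γ hΓ using hbase
  classical
  let φ : E → ℝ := fun x => if hx : x ∈ B then lineIntegral ω (Γ ⟨x, hx⟩) else 0
  refine ⟨φ, fun x hx => ?_⟩
  rw [hasFDerivAt_iff_isLittleO]
  refine (lineIntegral_smoothSegment_isLittleO hB hω hx).congr' ?_ .rfl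
  obtain ⟨δ, hδ, hball⟩ := Metric.mem_nhds_iff.1 (hB.mem_nhds hx)
  filter_upwards [Metric.ball_mem_nhds x hδ] with y hy
  have hyB := hball hy
  have hpath : IsSmoothPathIn B (smoothSegment x y) x y := isSmoothPathIn_smoothSegment
    (((convex_ball x δ).segment_subset (Metric.mem_ball_self hδ) hy).trans hball)
  have hb : base ⟨x, hx⟩ = base ⟨y, hyB⟩ :=
    congrArg Quotient.out (Quotient.sound (s := S) ⟨_, hpath⟩)
  have hxy := (hΓ ⟨x, hx⟩).concat hpath
  rw [hb] at hxy
  have := h.lineIntegral_eq hω hxy (hΓ ⟨y, hyB⟩)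
  rw [(hΓ ⟨x, hx⟩).lineIntegral_concat hω hpath] at this
  simp only [φ, dif_pos hx, dif_pos hyB]
  linarith

/-- A smooth 1-form on an open set with vanishing integrals along smooth closed curves has a
smooth potential. -/
theorem HasZeroPeriods.exists_contDiffOn_potential (h : HasZeroPeriods B ω) (hB : IsOpen B)
    (hω : ContDiffOn ℝ (⊤ : ℕ∞) ω B) :
    ∃ φ : E → ℝ, ContDiffOn ℝ (⊤ : ℕ∞) φ B ∧ ∀ x ∈ B, HasFDerivAt φ (ω x) x := by
  obtain ⟨φ, hφ⟩ := h.exists_hasFDerivAt hB hω.continuousOn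
  refine ⟨φ, (contDiffOn_infty_iff_fderiv_of_isOpen hB).2 ⟨fun x hx =>
    (hφ x hx).differentiableAt.differentiableWithinAt, hω.congr fun x hx => (hφ x hx).fderiv⟩, hφ⟩

/-- Exact 1-forms integrate to zero along closed curves. -/
lemma hasZeroPeriods_fderiv {φ : E → ℝ} (hB : IsOpen B) (hφ : ContDiffOn ℝ (⊤ : ℕ∞) φ B) :
    HasZeroPeriods B (fderiv ℝ φ) := by
  intro γ hγ hper hmem
  have hc : ContinuousOn (fderiv ℝ φ) B :=
    ((contDiffOn_infty_iff_fderiv_of_isOpen hB).1 hφ).2.continuousOn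
  have hd : ∀ t, HasDerivAt (fun s => φ (γ s)) (fderiv ℝ φ (γ t) (deriv γ t)) t := fun t =>
    ((hφ.contDiffAt (hB.mem_nhds (hmem t))).differentiableAt (by simp)).hasFDerivAt.comp_hasDerivAt
      t (hγ.differentiable (by simp) t).hasDerivAt
  rw [lineIntegral, intervalIntegral.integral_eq_sub_of_hasDerivAt (fun t _ => hd t)
    ((continuous_lineIntegrand hc hγ hmem).intervalIntegrable _ _)]
  have := hper 0
  rw [zero_add] at this
  rw [this, sub_self]

end LineIntegral

section PartialDerivatives

variable {n : ℕ} {B : Set (Fin n → ℝ)} {f g : (Fin n → ℝ) → ℝ} {x : Fin n → ℝ}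

lemma ContDiffOn.pd (hf : ContDiffOn ℝ (⊤ : ℕ∞) f B) (hB : IsOpen B) (K : Fin n) :
    ContDiffOn ℝ (⊤ : ℕ∞) (pd K f) B :=
  ((contDiffOn_infty_iff_fderiv_of_isOpen hB).1 hf).2.clm_apply contDiffOn_const

lemma ContDiffOn.hasFDerivAt_of_isOpen (hf : ContDiffOn ℝ (⊤ : ℕ∞) f B) (hB : IsOpen B)
    (hx : x ∈ B) : HasFDerivAt f (fderiv ℝ f x) x :=
  ((hf.contDiffAt (hB.mem_nhds hx)).differentiableAt (by simp)).hasFDerivAt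

lemma pd_eq_of_hasFDerivAt {f' : (Fin n → ℝ) →L[ℝ] ℝ} (h : HasFDerivAt f f' x) (K : Fin n) :
    pd K f x = f' (Pi.single K 1) := by
  rw [pd, h.fderiv]

lemma pd_congr (hB : IsOpen B) (h : EqOn f g B) (K : Fin n) (hx : x ∈ B) :
    pd K f x = pd K g x := by
  rw [pd, (h.eventuallyEq_of_mem (hB.mem_nhds hx)).fderiv_eq, pd]

lemma pd_comm (hf : ContDiffOn ℝ (⊤ : ℕ∞) f B) (hB : IsOpen B) (hx : x ∈ B) (K M : Fin n) :
    pd K (pd M f) x = pd M (pd K f) x := by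
  have hd : HasFDerivAt (fderiv ℝ f) (fderiv ℝ (fderiv ℝ f) x) x :=
    ((((contDiffOn_infty_iff_fderiv_of_isOpen hB).1 hf).2.contDiffAt
      (hB.mem_nhds hx)).differentiableAt (by simp)).hasFDerivAt
  have key : ∀ K M : Fin n, pd K (pd M f) x =
      fderiv ℝ (fderiv ℝ f) x (Pi.single K 1) (Pi.single M 1) := fun K M => by
    rw [pd_eq_of_hasFDerivAt (f := pd M f) (hd.clm_apply (hasFDerivAt_const _ _))]
    simp
  rw [key, key]
  exact (hf.contDiffAt (hB.mem_nhds hx)).isSymmSndFDerivAt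
    (by rw [minSmoothness_of_isRCLikeNormedField]; exact WithTop.coe_le_coe.2 (le_top : (2 : ℕ∞) ≤ ⊤)) _ _

lemma pd_add (hf : ContDiffOn ℝ (⊤ : ℕ∞) f B) (hg : ContDiffOn ℝ (⊤ : ℕ∞) g B) (hB : IsOpen B)
    (hx : x ∈ B) (K : Fin n) : pd K (fun y => f y + g y) x = pd K f x + pd K g x :=
  pd_eq_of_hasFDerivAt
    ((hf.hasFDerivAt_of_isOpen hB hx).add (hg.hasFDerivAt_of_isOpen hB hx)) K

lemma pd_sub (hf : ContDiffOn ℝ (⊤ : ℕ∞) f B) (hg : ContDiffOn ℝ (⊤ : ℕ∞) g B) (hB : IsOpen B)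
    (hx : x ∈ B) (K : Fin n) : pd K (fun y => f y - g y) x = pd K f x - pd K g x :=
  pd_eq_of_hasFDerivAt
    ((hf.hasFDerivAt_of_isOpen hB hx).sub (hg.hasFDerivAt_of_isOpen hB hx)) K

lemma pd_div_const (hf : ContDiffOn ℝ (⊤ : ℕ∞) f B) (hB : IsOpen B) (hx : x ∈ B) (c : ℝ)
    (K : Fin n) : pd K (fun y => f y / c) x = pd K f x / c := by
  simp only [div_eq_mul_inv]
  rw [pd_eq_of_hasFDerivAt ((hf.hasFDerivAt_of_isOpen hB hx).mul_const c⁻¹)]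
  simp [pd, mul_comm]

lemma contDiffOn_sum_coord_mul {w : Fin n → (Fin n → ℝ) → ℝ}
    (hw : ∀ K, ContDiffOn ℝ (⊤ : ℕ∞) (w K) B) :
    ContDiffOn ℝ (⊤ : ℕ∞) (fun y => ∑ K, y K * w K y) B :=
  ContDiffOn.sum fun K _ => (contDiff_apply ℝ ℝ K).contDiffOn.mul (hw K)

lemma pd_sum_coord_mul {w : Fin n → (Fin n → ℝ) → ℝ} (hw : ∀ K, ContDiffOn ℝ (⊤ : ℕ∞) (w K) B)
    (hB : IsOpen B) (hx : x ∈ B) (J : Fin n) :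
    pd J (fun y => ∑ K, y K * w K y) x = w J x + ∑ K, x K * pd J (w K) x := by
  have h := HasFDerivAt.fun_sum (u := Finset.univ) fun K _ =>
    (hasFDerivAt_apply (𝕜 := ℝ) K x).fun_mul ((hw K).hasFDerivAt_of_isOpen hB hx)
  rw [pd_eq_of_hasFDerivAt h]
  simp [Finset.sum_add_distrib, Pi.single_apply, pd, add_comm]

lemma sum_pd_mul (φ : (Fin n → ℝ) → ℝ) (x v : Fin n → ℝ) :
    ∑ K, pd K φ x * v K = fderiv ℝ φ x v := by
  conv_rhs => rw [pi_eq_sum_univ' v]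
  simp [pd, mul_comm]

lemma integral_pd_eq_zero (hB : IsOpen B) (hf : ContDiffOn ℝ (⊤ : ℕ∞) f B) {γ : ℝ → Fin n → ℝ}
    (hγ : IsSmoothClosedCurveIn B γ) :
    ∫ t in (0 : ℝ)..1, ∑ K, pd K f (γ t) * deriv γ t K = 0 := by
  simp only [sum_pd_mul]
  exact hasZeroPeriods_fderiv hB hf γ hγ.1 hγ.2.1 hγ.2.2

lemma exists_pd_potential (hB : IsOpen B) {F : Fin n → (Fin n → ℝ) → ℝ}
    (hF : ∀ K, ContDiffOn ℝ (⊤ : ℕ∞) (F K) B)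
    (h : ∀ γ : ℝ → Fin n → ℝ, IsSmoothClosedCurveIn B γ →
      ∫ t in (0 : ℝ)..1, ∑ K, F K (γ t) * deriv γ t K = 0) :
    ∃ φ : (Fin n → ℝ) → ℝ, ContDiffOn ℝ (⊤ : ℕ∞) φ B ∧ ∀ x ∈ B, ∀ K, pd K φ x = F K x := by
  let ω : (Fin n → ℝ) → (Fin n → ℝ) →L[ℝ] ℝ := fun x =>
    ∑ K, F K x • ContinuousLinearMap.proj K
  have hω : ContDiffOn ℝ (⊤ : ℕ∞) ω B := ContDiffOn.sum fun K _ => (hF K).smul contDiffOn_const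
  have hz : HasZeroPeriods B ω := fun γ h₁ h₂ h₃ => by
    simpa [lineIntegral, ω] using h γ ⟨h₁, h₂, h₃⟩
  obtain ⟨φ, hφ, hd⟩ := hz.exists_contDiffOn_potential hB hω
  refine ⟨φ, hφ, fun x hx K => ?_⟩
  rw [pd_eq_of_hasFDerivAt (hd x hx)]
  simp [ω, Pi.single_apply]

end PartialDerivatives

section SymmetrizedGradient

lemma sum_eps_mul_eq_zero (J : Fin 3) {S : Fin 3 → Fin 3 → ℝ} (hS : ∀ M N, S M N = S N M) :
    ∑ M, ∑ N, eps J M N * S M N = 0 := by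
  simp only [Fin.sum_univ_three, eps, hS 1 0, hS 2 0, hS 2 1]
  ring

/-- The algebraic identity behind `curl∘curl∘grad^s = 0`: `D L N M K` stands for
`∂_K ∂_M ∂_N Y^L`. -/
lemma sum_eps_eps_symm_eq_zero {D : Fin 3 → Fin 3 → Fin 3 → Fin 3 → ℝ}
    (h₁ : ∀ L N M K, D L N M K = D L M N K) (h₂ : ∀ L N M K, D L N M K = D L N K M)
    (I J : Fin 3) :
    ∑ K, ∑ L, ∑ M, ∑ N, eps I K L * eps J M N * ((D L N M K + D N L M K) / 2) = 0 := by
  have e₁ : ∑ K, ∑ L, ∑ M, ∑ N, eps I K L * eps J M N * (D L N M K / 2) = 0 := by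
    refine Finset.sum_eq_zero fun K _ => Finset.sum_eq_zero fun L _ => ?_
    have := sum_eps_mul_eq_zero J (S := fun M N => D L N M K / 2) fun M N => by rw [h₁]
    simp only [mul_assoc, ← Finset.mul_sum, this, mul_zero]
  have e₂ : ∑ K, ∑ L, ∑ M, ∑ N, eps I K L * eps J M N * (D N L M K / 2) = 0 := by
    have := sum_eps_mul_eq_zero I
      (S := fun K L => ∑ M, ∑ N, eps J M N * (D N L M K / 2)) fun K L => by
        refine Finset.sum_congr rfl fun M _ => Finset.sum_congr rfl fun N _ => ?_
        rw [h₂ N L M K, h₁ N L K M, h₂ N K L M]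
    simpa only [Finset.mul_sum, mul_assoc] using this
  simp only [add_div, mul_add, Finset.sum_add_distrib, e₁, e₂, add_zero]

variable {n : ℕ} {B : Set (Fin n → ℝ)} {T : (Fin n → ℝ) → Fin n → Fin n → ℝ}
  {Y : (Fin n → ℝ) → Fin n → ℝ} {x : Fin n → ℝ}

/-- `T = grad^s Y` on `B`. -/
def IsSymmGradientOn (B : Set (Fin n → ℝ)) (T : (Fin n → ℝ) → Fin n → Fin n → ℝ)
    (Y : (Fin n → ℝ) → Fin n → ℝ) : Prop :=
  ∀ x ∈ B, ∀ I J, T x I J = (pd J (fun y => Y y I) x + pd I (fun y => Y y J) x) / 2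

/-- The antisymmetric part of the gradient of `Y`. -/
noncomputable def rotationField (Y : (Fin n → ℝ) → Fin n → ℝ) (I J : Fin n) (x : Fin n → ℝ) : ℝ :=
  (pd J (fun y => Y y I) x - pd I (fun y => Y y J) x) / 2

lemma contDiffOn_rotationField (hB : IsOpen B)
    (hY : ∀ I, ContDiffOn ℝ (⊤ : ℕ∞) (fun y => Y y I) B) (I J : Fin n) :
    ContDiffOn ℝ (⊤ : ℕ∞) (rotationField Y I J) B :=
  (((hY I).pd hB J).sub ((hY J).pd hB I)).div_const 2

lemma IsSymmGradientOn.pd_eq (h : IsSymmGradientOn B T Y) (hB : IsOpen B)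
    (hY : ∀ I, ContDiffOn ℝ (⊤ : ℕ∞) (fun y => Y y I) B) (hx : x ∈ B) (I J K : Fin n) :
    pd K (fun y => T y I J) x =
      (pd K (pd J fun y => Y y I) x + pd K (pd I fun y => Y y J) x) / 2 := by
  rw [pd_congr hB (fun y hy => h y hy I J) K hx,
    pd_div_const (((hY I).pd hB J).add ((hY J).pd hB I)) hB hx,
    pd_add ((hY I).pd hB J) ((hY J).pd hB I) hB hx]

lemma IsSymmGradientOn.pd_pd_eq (h : IsSymmGradientOn B T Y) (hB : IsOpen B)
    (hY : ∀ I, ContDiffOn ℝ (⊤ : ℕ∞) (fun y => Y y I) B) (hx : x ∈ B) (I J K L : Fin n) :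
    pd L (pd K fun y => T y I J) x =
      (pd L (pd K (pd J fun y => Y y I)) x + pd L (pd K (pd I fun y => Y y J)) x) / 2 := by
  have h₁ := ((hY I).pd hB J).pd hB K
  have h₂ := ((hY J).pd hB I).pd hB K
  rw [pd_congr hB (fun y hy => h.pd_eq hB hY hy I J K) L hx,
    pd_div_const (h₁.add h₂) hB hx, pd_add h₁ h₂ hB hx]

lemma IsSymmGradientOn.pd_rotationField (h : IsSymmGradientOn B T Y) (hB : IsOpen B)
    (hY : ∀ I, ContDiffOn ℝ (⊤ : ℕ∞) (fun y => Y y I) B) (hx : x ∈ B) (I J K : Fin n) :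
    pd K (rotationField Y I J) x =
      pd J (fun y => T y I K) x - pd I (fun y => T y J K) x := by
  have h₁ := (hY I).pd hB J
  have h₂ := (hY J).pd hB I
  unfold rotationField
  rw [pd_div_const (h₁.sub h₂) hB hx, pd_sub h₁ h₂ hB hx, h.pd_eq hB hY hx, h.pd_eq hB hY hx,
    pd_comm (hY I) hB hx K J, pd_comm (hY J) hB hx K I, pd_comm (hY K) hB hx J I]
  ring

end SymmetrizedGradient

/-- A smooth symmetric (²₀)-tensor field `T` on an open set `B ⊆ ℝ³` is a symmetrized
gradient `grad^s Y` iff `curl∘curl T = 0` and the two families of line integrals over all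
smooth closed curves in `B` vanish. -/
theorem symmetrized_gradient_potential_iff_3d
    (B : Set (Fin 3 → ℝ)) (hB : IsOpen B)
    (T : (Fin 3 → ℝ) → Fin 3 → Fin 3 → ℝ)
    (hT : ContDiffOn ℝ (⊤ : ℕ∞) T B)
    (hsym : ∀ x ∈ B, ∀ I J, T x I J = T x J I) :
    (∃ Y : (Fin 3 → ℝ) → Fin 3 → ℝ,
        ContDiffOn ℝ (⊤ : ℕ∞) Y B ∧
        ∀ x ∈ B, ∀ I J,
          T x I J = (pd J (fun y => Y y I) x + pd I (fun y => Y y J) x) / 2) ↔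
      ((∀ x ∈ B, ∀ I J,
          (∑ K, ∑ L, ∑ M, ∑ N, eps I K L * eps J M N *
            pd K (fun y => pd M (fun z => T z L N) y) x) = 0) ∧
        (∀ γ : ℝ → Fin 3 → ℝ, IsSmoothClosedCurveIn B γ →
          ∀ I, (∫ t in (0:ℝ)..1, ∑ J,
            (T (γ t) I J - ∑ K, γ t K *
              (pd K (fun y => T y I J) (γ t) - pd I (fun y => T y J K) (γ t))) *
              deriv γ t J) = 0) ∧
        (∀ γ : ℝ → Fin 3 → ℝ, IsSmoothClosedCurveIn B γ →
          ∀ I J, (∫ t in (0:ℝ)..1, ∑ K,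
            (pd J (fun y => T y I K) (γ t) - pd I (fun y => T y J K) (γ t)) *
              deriv γ t K) = 0)) := by
  have hTc : ∀ I J, ContDiffOn ℝ (⊤ : ℕ∞) (fun y => T y I J) B := fun I J =>
    contDiffOn_pi.1 (contDiffOn_pi.1 hT I) J
  have hpds : ∀ x ∈ B, ∀ I J K, pd K (fun y => T y I J) x = pd K (fun y => T y J I) x :=
    fun x hx I J K => pd_congr hB (fun y hy => hsym y hy I J) K hx
  constructor
  · rintro ⟨Y, hYs, hY⟩
    have hY : IsSymmGradientOn B T Y := hY
    have hYc : ∀ I, ContDiffOn ℝ (⊤ : ℕ∞) (fun y => Y y I) B := contDiffOn_pi.1 hYs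
    refine ⟨fun x hx I J => ?_, fun γ hγ I => ?_, fun γ hγ I J => ?_⟩
    · simp only [hY.pd_pd_eq hB hYc hx]
      refine sum_eps_eps_symm_eq_zero
        (D := fun L N M K => pd K (pd M (pd N fun y => Y y L)) x) (fun L N M K => ?_)
        (fun L N M K => pd_comm ((hYc L).pd hB N) hB hx K M) I J
      exact pd_congr hB (fun y hy => pd_comm (hYc L) hB hy M N) K hx
    · have hW := contDiffOn_rotationField hB hYc I
      have hS := contDiffOn_sum_coord_mul hW
      refine Eq.trans (intervalIntegral.integral_congr fun t _ =>
        Finset.sum_congr rfl fun J _ => ?_) (integral_pd_eq_zero hB ((hYc I).sub hS) hγ)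
      have hx := hγ.2.2 t
      rw [pd_sub (hYc I) hS hB hx, pd_sum_coord_mul hW hB hx]
      simp only [hY.pd_rotationField hB hYc hx, hpds _ hx J _ I, hY _ hx I J, rotationField]
      ring
    · refine Eq.trans (intervalIntegral.integral_congr fun t _ => Finset.sum_congr rfl
        fun K _ => ?_) (integral_pd_eq_zero hB (contDiffOn_rotationField hB hYc I J) hγ)
      rw [hY.pd_rotationField hB hYc (hγ.2.2 t)]
  · rintro ⟨-, h₁, h₂⟩
    choose φ hφ hφd using fun I J => exists_pd_potential hB
      (F := fun K x => pd J (fun y => T y I K) x - pd I (fun y => T y J K) x)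
      (fun K => ((hTc I K).pd hB J).sub ((hTc J K).pd hB I)) fun γ hγ => h₂ γ hγ I J
    let W : Fin 3 → Fin 3 → (Fin 3 → ℝ) → ℝ := fun I J x => (φ I J x - φ J I x) / 2
    have hW : ∀ I J, ContDiffOn ℝ (⊤ : ℕ∞) (W I J) B := fun I J =>
      ((hφ I J).sub (hφ J I)).div_const 2
    have hWd : ∀ x ∈ B, ∀ I J K, pd K (W I J) x =
        pd J (fun y => T y I K) x - pd I (fun y => T y J K) x := fun x hx I J K => by
      rw [pd_div_const ((hφ I J).sub (hφ J I)) hB hx, pd_sub (hφ I J) (hφ J I) hB hx,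
        hφd I J x hx, hφd J I x hx]
      ring
    choose Z hZ hZd using fun I => exists_pd_potential hB
      (F := fun J x => T x I J - ∑ K, x K *
        (pd K (fun y => T y I J) x - pd I (fun y => T y J K) x))
      (fun J => (hTc I J).sub (contDiffOn_sum_coord_mul fun K =>
        ((hTc I J).pd hB K).sub ((hTc J K).pd hB I))) fun γ hγ => h₁ γ hγ I
    have hS := fun I => contDiffOn_sum_coord_mul (hW I)
    refine ⟨fun x I => Z I x + ∑ K, x K * W I K x,
      contDiffOn_pi.2 fun I => (hZ I).add (hS I), fun x hx => ?_⟩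
    have hY : ∀ I J, pd J (fun y => Z I y + ∑ K, y K * W I K y) x = T x I J + W I J x :=
      fun I J => by
        rw [pd_add (hZ I) (hS I) hB hx, pd_sum_coord_mul (hW I) hB hx, hZd I x hx]
        simp only [hWd x hx, hpds x hx J _ I]
        ring
    intro I J
    rw [hY, hY, hsym x hx J I]
    simp only [W]
    ring
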